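/- Let M be a matroid on a finite ground set E and let ω : E → ℝ be a weight function. Then there exists a matroid N on the same ground set E whose circuits are exactly the inclusion-minimal members of the collection {init_ω(C) : C a circuit of M}. -/

import Mathlib

/-- `initW ω C` is the set of `ω`-maximal elements of `C`. -/
def initW {α : Type*} (ω : α → ℝ) (C : Set α) : Set α :=
  {e ∈ C | ∀ f ∈ C, ω f ≤ ω e}

/-- A circuit of a matroid is a minimal dependent set. -/
def IsCircuit {α : Type*} (M : Matroid α) (C : Set α) : Prop :=
  Minimal M.Dep C

open Set in
theorem stmt0_aux {α : Type*} (M : Matroid α) (hfin : M.E.Finite) (ω : α → ℝ) :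
    ∃ N : Matroid α, N.E = M.E ∧
      ∀ X : Set α, N.Dep X ↔ X ⊆ M.E ∧ ∃ C, M.IsCircuit C ∧ initW ω C ⊆ X := by
  let S : ℝ → Set α := fun t => {e | e ∈ M.E ∧ ω e = t}
  let Mt : ℝ → Matroid α := fun t => (M.contract {e | ω e < t}).restrict (S t)
  have hd : Pairwise (Function.onFun Disjoint fun t => (Mt t).E) := by
    intro s t hst
    refine Set.disjoint_left.2 ?_
    rintro e ⟨_, h1⟩ ⟨_, h2⟩
    exact hst (h1.symm.trans h2)
  have hE : (⋃ t, (Mt t).E) = M.E := by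
    ext e
    simp [Mt, S]
  refine ⟨Matroid.disjointSigma Mt hd, by rw [Matroid.disjointSigma_ground_eq, hE], fun X => ?_⟩
  rw [Matroid.dep_iff, Matroid.disjointSigma_indep_iff, Matroid.disjointSigma_ground_eq, hE]
  have key : ∀ t, (Mt t).Indep (X ∩ (Mt t).E) ↔ (M.contract {e | ω e < t}).Indep (X ∩ S t) := by
    intro t
    simp [Mt, Matroid.restrict_indep_iff]
  constructor
  · rintro ⟨h1, h2⟩
    refine ⟨h2, ?_⟩
    have h3 : ∃ t, ¬ (M.contract {e | ω e < t}).Indep (X ∩ S t) := by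
      by_contra hcon
      push Not at hcon
      exact h1 ⟨fun t => (key t).2 (hcon t), h2⟩
    obtain ⟨t, ht⟩ := h3
    have hdep : (M.contract {e | ω e < t}).Dep (X ∩ S t) := by
      refine ⟨ht, ?_⟩
      rintro e ⟨_, he, het⟩
      refine ⟨he, ?_⟩
      simp [het]
    obtain ⟨K, hKX, hK⟩ := hdep.exists_isCircuit_subset
    obtain ⟨C, hC, hKC, hCK⟩ := hK.exists_subset_isCircuit_of_contract
    refine ⟨C, hC, ?_⟩
    rintro e ⟨heC, hmax⟩
    rcases hCK heC with h | h
    · exact (hKX h).1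
    · obtain ⟨k, hk⟩ := hK.nonempty
      have h4 := hmax k (hKC hk)
      have h5 : ω k = t := (hKX hk).2.2
      have h6 : ω e < t := h
      linarith
  · rintro ⟨hX, C, hC, hCX⟩
    refine ⟨?_, hX⟩
    rintro ⟨h1, -⟩
    obtain ⟨m, hm, hmax⟩ := Set.exists_max_image C ω (hfin.subset hC.subset_ground) hC.nonempty
    have hdep := hC.contract_dep_of_not_subset (C := {e | ω e < ω m})
      (fun h => lt_irrefl (ω m) (show ω m < ω m from h hm))
    refine hdep.not_indep (((key (ω m)).1 (h1 _)).subset ?_)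
    rintro e ⟨heC, he⟩
    have he' : ω m ≤ ω e := not_lt.1 he
    exact ⟨hCX ⟨heC, fun f hf => (hmax f hf).trans he'⟩, hC.subset_ground heC,
      le_antisymm (hmax e heC) he'⟩

/-- Given a matroid `M` on a finite ground set and a weight function `ω`, there is a
matroid `N` on the same ground set whose circuits are exactly the inclusion-minimal
members of the collection `{initW ω C : C a circuit of M}`. -/
theorem stmt0 {α : Type*} (M : Matroid α) (hfin : M.E.Finite) (ω : α → ℝ) :
    ∃ N : Matroid α, N.E = M.E ∧
      ∀ X : Set α, IsCircuit N X ↔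
        Minimal (fun Y : Set α => ∃ C, IsCircuit M C ∧ Y = initW ω C) X := by
  obtain ⟨N, hE, hN⟩ := stmt0_aux M hfin ω
  refine ⟨N, hE, fun X => ?_⟩
  have hI : ∀ C, M.IsCircuit C → N.Dep (initW ω C) := fun C hC =>
    (hN _).2 ⟨fun e he => hC.subset_ground he.1, C, hC, subset_rfl⟩
  constructor
  · intro h
    obtain ⟨-, C, hC, hCX⟩ := (hN X).1 h.prop
    have hXC : X = initW ω C := (h.le_of_le (hI C hC) hCX).antisymm hCX
    refine ⟨⟨C, hC, hXC⟩, ?_⟩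
    rintro Y ⟨D, hD, rfl⟩ hY
    exact h.le_of_le (hI D hD) hY
  · rintro ⟨⟨C, hC, rfl⟩, hmin⟩
    refine ⟨hI C hC, fun Y hY hYC => ?_⟩
    obtain ⟨-, D, hD, hDY⟩ := (hN Y).1 hY
    exact le_trans (hmin ⟨D, hD, rfl⟩ (le_trans hDY hYC)) hDY
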